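/- Let u ∈ C^1(Ω;ℝ^n) and ψ ∈ C^1_c(Ω). Then for almost every a ∈ ℝ^n the function x ↦ j u^a(x)·∇ψ(x) is integrable on Ω, the function a ↦ −∫_Ω j u^a(x)·∇ψ(x) dx is integrable on ℝ^n, and the weak coarea formula for smooth maps holds: ∫_Ω det∇u(x) ψ(x) dx = (1/ω_n) ∫_{ℝ^n} ( −∫_Ω j u^a(x)·∇ψ(x) dx ) da. -/

import Mathlib

open MeasureTheory Metric Filter Topology

noncomputable section

abbrev Euc (n : ℕ) := EuclideanSpace ℝ (Fin n)

/-- The Jacobian matrix `∇u(x)` of a map `u : ℝⁿ → ℝⁿ`, with entries `∂_j u_i (x)`. -/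
def jacMat (n : ℕ) (u : Euc n → Euc n) (x : Euc n) : Matrix (Fin n) (Fin n) ℝ :=
  Matrix.of fun i j => fderiv ℝ u x (EuclideanSpace.single j 1) i

/-- The vector field `j u := (1/n) (cof ∇u)ᵀ u` (componentwise); note that
`(cof A)ᵀ = adjugate A`. -/
def jvec (n : ℕ) (u : Euc n → Euc n) (x : Euc n) : Fin n → ℝ :=
  fun i => (n : ℝ)⁻¹ * Matrix.mulVec (Matrix.adjugate (jacMat n u x)) (fun j => u x j) i

/-- The pointwise pairing `j u (x) · ∇ψ(x)`. -/
def jPair (n : ℕ) (u : Euc n → Euc n) (ψ : Euc n → ℝ) (x : Euc n) : ℝ :=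
  ∑ i, jvec n u x i * fderiv ℝ ψ x (EuclideanSpace.single i 1)

/-- `ψ ∈ C¹_c(Ω)`. -/
def Cc1 (n : ℕ) (Ω : Set (Euc n)) (ψ : Euc n → ℝ) : Prop :=
  ContDiff ℝ 1 ψ ∧ HasCompactSupport ψ ∧ tsupport ψ ⊆ Ω

/-- The fractional Sobolev seminorm `[u]_{W^{s,p}(Ω)}`. -/
def sobSemi (n : ℕ) (s p : ℝ) (Ω : Set (Euc n)) {F : Type*} [NormedAddCommGroup F]
    (u : Euc n → F) : ℝ :=
  (∫ x in Ω, ∫ y in Ω, ‖u x - u y‖ ^ p / dist x y ^ ((n : ℝ) + s * p)) ^ (1 / p)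

/-- The fractional Sobolev norm `‖u‖_{W^{s,p}(Ω)} = ‖u‖_{L^p(Ω)} + [u]_{W^{s,p}(Ω)}`. -/
def sobNorm (n : ℕ) (s p : ℝ) (Ω : Set (Euc n)) {F : Type*} [NormedAddCommGroup F]
    (u : Euc n → F) : ℝ :=
  (∫ x in Ω, ‖u x‖ ^ p) ^ (1 / p) + sobSemi n s p Ω u

/-- Membership `u ∈ W^{s,p}(Ω; F)`: `u ∈ L^p(Ω)` and the double integral defining
`[u]_{W^{s,p}(Ω)}^p` is finite. -/
def MemWsp (n : ℕ) (s p : ℝ) (Ω : Set (Euc n)) {F : Type*} [NormedAddCommGroup F]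
    (u : Euc n → F) : Prop :=
  AEStronglyMeasurable u (volume.restrict Ω) ∧
  Integrable (fun x => ‖u x‖ ^ p) (volume.restrict Ω) ∧
  Integrable (fun q : Euc n × Euc n => ‖u q.1 - u q.2‖ ^ p / dist q.1 q.2 ^ ((n : ℝ) + s * p))
    ((volume.restrict Ω).prod (volume.restrict Ω))

/-- `Ω` has smooth boundary: it is a sublevel set of a smooth function whose
differential does not vanish on the boundary. -/
def SmoothBoundary (n : ℕ) (Ω : Set (Euc n)) : Prop :=
  ∃ f : Euc n → ℝ, ContDiff ℝ (⊤ : ℕ∞) f ∧ Ω = f ⁻¹' Set.Iio 0 ∧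
    ∀ x ∈ frontier Ω, fderiv ℝ f x ≠ 0

/-- `u^a(x) = (u(x) - a)/|u(x) - a|`. -/
def proj (n : ℕ) (u : Euc n → Euc n) (a : Euc n) : Euc n → Euc n :=
  fun x => ‖u x - a‖⁻¹ • (u x - a)

/-- The set of Hölder quotients of `u` on `Ω`. -/
def holderSet (n : ℕ) (α : ℝ) (Ω : Set (Euc n)) {F : Type*} [NormedAddCommGroup F]
    (u : Euc n → F) : Set ℝ :=
  {r | ∃ x ∈ Ω, ∃ y ∈ Ω, x ≠ y ∧ r = ‖u x - u y‖ / dist x y ^ α}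

/-- The Hölder seminorm `[u]_{C^{0,α}(Ω)}`. -/
def holderSemi (n : ℕ) (α : ℝ) (Ω : Set (Euc n)) {F : Type*} [NormedAddCommGroup F]
    (u : Euc n → F) : ℝ :=
  sSup (holderSet n α Ω u)

/-- The Hölder norm `‖u‖_{C^{0,α}(Ω)} = sup_Ω ‖u‖ + [u]_{C^{0,α}(Ω)}`. -/
def holderNorm (n : ℕ) (α : ℝ) (Ω : Set (Euc n)) {F : Type*} [NormedAddCommGroup F]
    (u : Euc n → F) : ℝ :=
  sSup {r | ∃ x ∈ Ω, r = ‖u x‖} + holderSemi n α Ω u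

/-- the volume `ω_n` of the unit ball of `ℝⁿ`. -/
def ballVol (n : ℕ) : ℝ := (volume (ball (0 : Euc n) 1)).toReal

/-- `⟨Jv, ψ⟩ = J` for `v ∈ W^{(n-1)/n, n}(Ω; ℝⁿ)`: approximating sequences of maps which are
`C¹` up to the boundary exist, and for every such sequence the Jacobian integrals converge
to `J`. -/
def JPairing (n : ℕ) (Ω : Set (Euc n)) (v : Euc n → Euc n) (ψ : Euc n → ℝ) (J : ℝ) : Prop :=
  (∃ vk : ℕ → Euc n → Euc n, (∀ k, ContDiffOn ℝ 1 (vk k) (closure Ω)) ∧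
      Tendsto (fun k => sobNorm n (((n : ℝ) - 1) / n) n Ω (vk k - v)) atTop (𝓝 0) ∧
      Tendsto (fun k => ∫ x in Ω, (jacMat n (vk k) x).det * ψ x) atTop (𝓝 J)) ∧
  (∀ vk : ℕ → Euc n → Euc n, (∀ k, ContDiffOn ℝ 1 (vk k) (closure Ω)) →
      Tendsto (fun k => sobNorm n (((n : ℝ) - 1) / n) n Ω (vk k - v)) atTop (𝓝 0) →
      Tendsto (fun k => ∫ x in Ω, (jacMat n (vk k) x).det * ψ x) atTop (𝓝 J))

/-- The set of values `⟨Jv, ψ⟩` over test functions `ψ ∈ C¹_c(Ω)` with `|ψ| ≤ 1`;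
its supremum is the total variation `|Jv|_{TV}`. -/
def TVset (n : ℕ) (Ω : Set (Euc n)) (v : Euc n → Euc n) : Set ℝ :=
  {r | ∃ ψ : Euc n → ℝ, Cc1 n Ω ψ ∧ (∀ x, |ψ x| ≤ 1) ∧ JPairing n Ω v ψ r}

/-- `⟨Jv, ψ⟩ = -∫_Ω j v · ∇ψ` for (pointwise defined) `v`. -/
def jpairOn (n : ℕ) (Ω : Set (Euc n)) (v : Euc n → Euc n) (ψ : Euc n → ℝ) : ℝ :=
  -∫ x in Ω, jPair n v ψ x

/-- The `W^{-1,1}(Ω)` distance between two functionals on test functions: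
`sup { S ψ - T ψ : ψ ∈ C¹_c(Ω), Lip ψ ≤ 1 }`. -/
def Wm11dist (n : ℕ) (Ω : Set (Euc n)) (S T : (Euc n → ℝ) → ℝ) : ℝ :=
  sSup {r | ∃ ψ : Euc n → ℝ, Cc1 n Ω ψ ∧ LipschitzWith 1 ψ ∧ r = S ψ - T ψ}


theorem det_jac (n : ℕ) (w : Euc n → Euc n) (x : Euc n) :
    (fderiv ℝ w x).det = (jacMat n w x).det := by
  rw [ContinuousLinearMap.det,
    ← LinearMap.det_toMatrix (EuclideanSpace.basisFun (Fin n) ℝ).toBasis]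
  congr 1

theorem det_jac_clm (n : ℕ) (L : Euc n →L[ℝ] Euc n) :
    L.det = (Matrix.of fun i j => L (EuclideanSpace.single j 1) i).det := by
  rw [ContinuousLinearMap.det,
    ← LinearMap.det_toMatrix (EuclideanSpace.basisFun (Fin n) ℝ).toBasis]
  congr 1

theorem det_one_add_smul_expand (n : ℕ) (A : Matrix (Fin n) (Fin n) ℝ) (t : ℝ) :
    (1 + t • A).det = ∑ s : Finset (Fin n), t ^ s.card *
      Matrix.det (Matrix.of (s.piecewise (fun i => A i) (fun i => (1 : Matrix (Fin n) (Fin n) ℝ) i))) := by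
  have h := (Matrix.detRowAlternating (R := ℝ) (n := Fin n)).toMultilinearMap.map_add_univ
    (fun i => t • A i) (fun i => (1 : Matrix (Fin n) (Fin n) ℝ) i)
  have e : (1 + t • A) = Matrix.of ((fun i => t • A i) + (fun i => (1 : Matrix (Fin n) (Fin n) ℝ) i)) := by
    ext i j; simp [add_comm]
  rw [e]
  refine h.trans (Finset.sum_congr rfl fun s _ => ?_)
  have h2 := (Matrix.detRowAlternating (R := ℝ) (n := Fin n)).toMultilinearMap.map_piecewise_smul
    (fun _ => t) (s.piecewise (fun i => A i) (fun i => (1 : Matrix (Fin n) (Fin n) ℝ) i)) s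
  rw [Finset.prod_const, smul_eq_mul] at h2
  refine Eq.trans ?_ h2
  congr 1
  ext i j
  by_cases hi : i ∈ s <;> simp [hi]

theorem jac_continuous (n : ℕ) (w : Euc n → Euc n) (hw : ContDiff ℝ 1 w) :
    Continuous (jacMat n w) := by
  have := hw.continuous_fderiv one_ne_zero
  refine continuous_matrix fun i j => ?_
  simp only [jacMat, Matrix.of_apply]
  fun_prop

theorem integral_det_zero (n : ℕ) (hn : 1 ≤ n) (w : Euc n → Euc n) (hw : ContDiff ℝ 1 w)
    (hc : HasCompactSupport w) : ∫ x, (jacMat n w x).det = 0 := by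
  obtain ⟨R, hR⟩ := hc.isBounded.subset_ball 0
  set B := ball (0 : Euc n) R with hB
  have hout : ∀ x ∉ B, w x = 0 := fun x hx => by
    by_contra h
    exact hx (hR (subset_tsupport _ h))
  have hJ := jac_continuous n w hw
  -- reduce to ball
  have h0 : ∫ x, (jacMat n w x).det = ∫ x in B, (jacMat n w x).det := by
    symm
    apply setIntegral_eq_integral_of_forall_compl_eq_zero
    intro x hx
    have hx' : x ∉ tsupport w := fun h => hx (hR h)
    have : fderiv ℝ w x = 0 := by
      have := support_fderiv_subset ℝ (f := w)
      by_contra h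
      exact hx' (this h)
    have : jacMat n w x = 0 := by
      ext i j; simp [jacMat, this]
    have : Nonempty (Fin n) := ⟨⟨0, hn⟩⟩
    rw [‹jacMat n w x = 0›, Matrix.det_zero]
  -- small t
  obtain ⟨C, hC⟩ := ContDiff.lipschitzWith_of_hasCompactSupport hc hw one_ne_zero
  have hbd : ∃ M : ℝ, 0 < M ∧ ∀ x, ‖fderiv ℝ w x‖ ≤ M := by
    refine ⟨C + 1, by positivity, fun x => ?_⟩
    exact (norm_fderiv_le_of_lipschitz ℝ hC).trans (by simp)
  have hdetc : Continuous (fun L : Euc n →L[ℝ] Euc n => L.det) := ContinuousLinearMap.continuous_det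
  have hpos : ∃ δ > 0, ∀ L : Euc n →L[ℝ] Euc n, ‖L - ContinuousLinearMap.id ℝ _‖ < δ → 0 < L.det := by
    have h1 : 0 < (ContinuousLinearMap.id ℝ (Euc n)).det := by
      simp [ContinuousLinearMap.det]
    obtain ⟨δ, hδ, h⟩ := Metric.eventually_nhds_iff.1 (hdetc.continuousAt.eventually (lt_mem_nhds h1))
    exact ⟨δ, hδ, fun L hL => h (by rwa [dist_eq_norm])⟩
  obtain ⟨M, hM, hbd⟩ := hbd
  obtain ⟨δ, hδ, hpos⟩ := hpos
  have key : ∀ t : ℝ, 0 < t → t < min (δ / M) (1 / (C + 1)) →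
      ∫ x in B, (1 + t • jacMat n w x).det = volume.real B := by
    intro t ht ht'
    have ht1 : t * M < δ := by
      have := lt_of_lt_of_le ht' (min_le_left _ _)
      rwa [lt_div_iff₀ hM] at this
    have ht2 : t * C < 1 := by
      have := lt_of_lt_of_le ht' (min_le_right _ _)
      rw [lt_div_iff₀ (by positivity)] at this
      nlinarith
    set g : Euc n → Euc n := fun x => x + t • w x with hg
    have hgd : ∀ x, HasFDerivAt g (ContinuousLinearMap.id ℝ _ + t • fderiv ℝ w x) x := fun x =>
      (hasFDerivAt_id x).add ((hw.differentiable one_ne_zero x).hasFDerivAt.const_smul t)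
    have hdet : ∀ x, (ContinuousLinearMap.id ℝ _ + t • fderiv ℝ w x).det
        = (1 + t • jacMat n w x).det := by
      intro x
      rw [det_jac_clm]
      congr 1
      ext i j
      simp [jacMat, Matrix.one_apply]
    have hdpos : ∀ x, 0 < (ContinuousLinearMap.id ℝ _ + t • fderiv ℝ w x).det := by
      intro x
      apply hpos
      rw [add_sub_cancel_left, norm_smul, Real.norm_of_nonneg ht.le]
      exact lt_of_le_of_lt (mul_le_mul_of_nonneg_left (hbd x) ht.le) ht1
    have happ : ApproximatesLinearOn g ((ContinuousLinearEquiv.refl ℝ (Euc n) : Euc n ≃L[ℝ] Euc n) : Euc n →L[ℝ] Euc n) Set.univ (Real.toNNReal t * C) := by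
      intro x _ y _
      have : g x - g y - ((ContinuousLinearEquiv.refl ℝ (Euc n) : Euc n ≃L[ℝ] Euc n) : Euc n →L[ℝ] Euc n) (x - y) = t • (w x - w y) := by
        simp [hg, smul_sub]; abel
      rw [this, norm_smul, Real.norm_of_nonneg ht.le]
      have := hC.dist_le_mul x y
      rw [dist_eq_norm, dist_eq_norm] at this
      rw [NNReal.coe_mul, Real.coe_toNNReal _ ht.le]
      calc t * ‖w x - w y‖ ≤ t * (C * ‖x - y‖) := by gcongr
        _ = _ := by ring
    have hcond : Subsingleton (Euc n) ∨ (Real.toNNReal t * C : NNReal) <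
        ‖((ContinuousLinearEquiv.refl ℝ (Euc n)).symm : Euc n →L[ℝ] Euc n)‖₊⁻¹ := by
      right
      have : Nonempty (Fin n) := ⟨⟨0, hn⟩⟩
      have : ‖((ContinuousLinearEquiv.refl ℝ (Euc n)).symm : Euc n →L[ℝ] Euc n)‖₊ = 1 := by
        ext
        simp
      rw [this, inv_one, ← NNReal.coe_lt_coe, NNReal.coe_mul, Real.coe_toNNReal _ ht.le]
      simpa using ht2
    have hinj : Set.InjOn g Set.univ := happ.injOn hcond
    have hsurj : Function.Surjective g := happ.surjective hcond
    have himg : g '' B = B := by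
      ext y
      constructor
      · rintro ⟨x, hx, rfl⟩
        by_contra hy
        have h1 : g (g x) = g x := by
          change g x + t • w (g x) = g x
          simp [hout _ hy]
        have := hinj (Set.mem_univ _) (Set.mem_univ _) h1
        rw [this] at hy
        exact hy hx
      · intro hy
        obtain ⟨x, rfl⟩ := hsurj y
        refine ⟨x, ?_, rfl⟩
        by_contra hx
        have : g x = x := by simp [hg, hout _ hx]
        rw [this] at hy
        exact hx hy
    have hcv := lintegral_abs_det_fderiv_eq_addHaar_image volume (measurableSet_ball (x := (0:Euc n)) (ε := R))
      (fun x _ => (hgd x).hasFDerivWithinAt) (hinj.mono (Set.subset_univ _))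
    rw [himg] at hcv
    rw [integral_eq_lintegral_of_nonneg_ae, Measure.real, ← hcv]
    · congr 1
      apply lintegral_congr
      intro x
      rw [← hdet, abs_of_pos (hdpos x)]
    · exact Eventually.of_forall fun x => by
        simp only [Pi.zero_apply]
        rw [← hdet]; exact (hdpos x).le
    · apply Continuous.aestronglyMeasurable
      exact (continuous_const.add (hJ.const_smul t)).matrix_det
  -- polynomial
  set I : Finset (Fin n) → ℝ := fun s => ∫ x in B, Matrix.det (Matrix.of (s.piecewise (fun i => jacMat n w x i) (fun i => (1 : Matrix (Fin n) (Fin n) ℝ) i))) with hI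
  have hcont : ∀ s : Finset (Fin n), Continuous fun x => Matrix.det (Matrix.of (s.piecewise (fun i => jacMat n w x i) (fun i => (1 : Matrix (Fin n) (Fin n) ℝ) i))) := by
    intro s
    apply Continuous.matrix_det
    refine continuous_matrix fun i j => ?_
    by_cases hi : i ∈ s
    · simp only [Matrix.of_apply, Finset.piecewise_eq_of_mem _ _ _ hi]
      exact hJ.matrix_elem i j
    · simp only [Matrix.of_apply, Finset.piecewise_eq_of_notMem _ _ _ hi]
      exact continuous_const
  have hexp : ∀ t : ℝ, ∫ x in B, (1 + t • jacMat n w x).det = ∑ s, t ^ s.card * I s := by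
    intro t
    simp_rw [det_one_add_smul_expand]
    rw [integral_finsetSum]
    · simp_rw [integral_const_mul]; rfl
    · intro s _
      apply Integrable.const_mul
      exact ((hcont s).continuousOn.integrableOn_compact (isCompact_closedBall 0 R)).mono_set ball_subset_closedBall
  let P : Polynomial ℝ := (∑ s : Finset (Fin n), Polynomial.C (I s) * Polynomial.X ^ s.card) - Polynomial.C (volume.real B)
  have hP : P = 0 := by
    apply Polynomial.eq_zero_of_infinite_isRoot
    have hε : 0 < min (δ / M) (1 / ((C:ℝ) + 1)) := by positivity
    refine (Set.Ioo_infinite hε).mono ?_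
    intro t ht
    have h1 := key t ht.1 ht.2
    rw [hexp] at h1
    simp only [Set.mem_ofPred_eq, Polynomial.IsRoot, P, Polynomial.eval_sub, Polynomial.eval_finsetSum, Polynomial.eval_mul, Polynomial.eval_C, Polynomial.eval_pow, Polynomial.eval_X]
    rw [← h1, sub_eq_zero]
    exact Finset.sum_congr rfl fun s _ => mul_comm _ _
  have hco := congrArg (fun p => Polynomial.coeff p n) hP
  simp only [P, Polynomial.coeff_sub, Polynomial.finsetSum_coeff, Polynomial.coeff_C_mul, Polynomial.coeff_X_pow, Polynomial.coeff_C, Polynomial.coeff_zero] at hco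
  rw [if_neg (by omega), sub_zero, Finset.sum_eq_single Finset.univ] at hco
  · rw [h0]
    have h2 : I Finset.univ = 0 := by simpa using hco
    rw [← h2, hI]
    simp only [Finset.piecewise_univ]
    rfl
  · intro s _ hs
    rw [if_neg, mul_zero]
    intro h
    apply hs
    rw [← Finset.card_eq_iff_eq_univ]
    simp [← h]
  · simp

theorem det_updateRow_adj (n : ℕ) (A : Matrix (Fin n) (Fin n) ℝ) (k : Fin n) (r : Fin n → ℝ) :
    (A.updateRow k r).det = ∑ i, A.adjugate i k * r i := by
  rw [← Matrix.cramer_transpose_apply, Matrix.cramer_eq_adjugate_mulVec, ← Matrix.adjugate_transpose]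
  rfl

theorem euc_sum_single (n : ℕ) (y : Euc n) : y = ∑ l, y l • EuclideanSpace.single l (1 : ℝ) := by
  ext i
  simp [Finset.sum_apply, Pi.single_apply]

theorem piola (n : ℕ) (v : Euc n → Euc n) (hv : ContDiff ℝ 1 v) (hvc : HasCompactSupport v)
    (ψ : Euc n → ℝ) (hψ : ContDiff ℝ 1 ψ) (hψc : HasCompactSupport ψ)
    (f : Euc n → ℝ) (hf : ContDiff ℝ 1 f) (k : Fin n) :
    ∫ x, ((∑ i, (jacMat n v x).adjugate i k * fderiv ℝ ψ x (EuclideanSpace.single i 1)) * f (v x)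
      + ψ x * fderiv ℝ f (v x) (EuclideanSpace.single k 1) * (jacMat n v x).det) = 0 := by
  have hn : 1 ≤ n := by have := k.2; omega
  set w : Euc n → Euc n := fun x => v x + (ψ x * f (v x) - v x k) • EuclideanSpace.single k (1 : ℝ) with hw
  have hvk : ContDiff ℝ 1 fun x => v x k := by fun_prop
  have hwC : ContDiff ℝ 1 w := by
    refine hv.add (ContDiff.smul ((hψ.mul (hf.comp hv)).sub hvk) contDiff_const)
  have hwc : HasCompactSupport w := by
    have hK := hvc.isCompact.union hψc.isCompact
    refine HasCompactSupport.intro hK fun x hx => ?_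
    rw [Set.mem_union, not_or] at hx
    have h1 : v x = 0 := image_eq_zero_of_notMem_tsupport hx.1
    have h2 : ψ x = 0 := image_eq_zero_of_notMem_tsupport hx.2
    simp [hw, h1, h2]
  rw [← integral_det_zero n hn w hwC hwc]
  refine integral_congr_ae (Eventually.of_forall fun x => ?_)
  have hdv := (hv.differentiable one_ne_zero x).hasFDerivAt
  have hdf := (hf.differentiable one_ne_zero (v x)).hasFDerivAt
  have hdψ := (hψ.differentiable one_ne_zero x).hasFDerivAt
  have hdk : HasFDerivAt (fun x => v x k) ((EuclideanSpace.proj k : Euc n →L[ℝ] ℝ).comp (fderiv ℝ v x)) x :=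
    (EuclideanSpace.proj k : Euc n →L[ℝ] ℝ).hasFDerivAt.comp x hdv
  have hdw := hdv.add (((hdψ.mul (hdf.comp x hdv)).sub hdk).smul_const (EuclideanSpace.single k (1 : ℝ)))
  have hJ : jacMat n w x = (jacMat n v x).updateRow k (fun j =>
      f (v x) * fderiv ℝ ψ x (EuclideanSpace.single j 1)
       + ψ x * ∑ l, jacMat n v x l j * fderiv ℝ f (v x) (EuclideanSpace.single l 1)) := by
    ext i j
    have e : ∑ l, jacMat n v x l j * fderiv ℝ f (v x) (EuclideanSpace.single l 1)
        = fderiv ℝ f (v x) (fderiv ℝ v x (EuclideanSpace.single j 1)) := by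
      conv_rhs => rw [euc_sum_single n (fderiv ℝ v x (EuclideanSpace.single j 1))]
      simp [map_sum, jacMat]
    have : fderiv ℝ w x = _ := hdw.fderiv
    rw [jacMat, Matrix.of_apply, this]
    by_cases hik : i = k
    · subst hik
      rw [Matrix.updateRow_self, e]
      simp
      ring
    · simp [hik, Matrix.updateRow_ne, jacMat]
  simp only
  rw [hJ, det_updateRow_adj]
  simp only [mul_add, Finset.sum_add_distrib]
  congr 1
  · rw [Finset.sum_mul]
    exact Finset.sum_congr rfl fun i _ => by ring
  · have hA : ∀ l, ∑ j, jacMat n v x l j * (jacMat n v x).adjugate j k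
        = if l = k then (jacMat n v x).det else 0 := by
      intro l
      rw [← Matrix.mul_apply, Matrix.mul_adjugate]
      simp [Matrix.one_apply]
    calc _ = ψ x * ∑ l, fderiv ℝ f (v x) (EuclideanSpace.single l 1) *
            ∑ j, jacMat n v x l j * (jacMat n v x).adjugate j k := by
          simp [hA]; ring
      _ = _ := by
          simp only [Finset.mul_sum]
          rw [Finset.sum_comm]
          exact Finset.sum_congr rfl fun i _ => Finset.sum_congr rfl fun j _ => by ring

theorem adj_proj (n : ℕ) (e : Fin n → ℝ) (he : e ⬝ᵥ e = 1) :
    (1 - Matrix.vecMulVec e e).adjugate.mulVec e = e := by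
  have hne : ∀ t : ℝ, t ≠ 1 → (1 - t • Matrix.vecMulVec e e).adjugate.mulVec e = e := by
    intro t ht
    have hM : (1 - t • Matrix.vecMulVec e e).mulVec e = (1 - t) • e := by
      rw [Matrix.sub_mulVec, Matrix.smul_mulVec, Matrix.vecMulVec_mulVec, he]
      simp [sub_smul]
    have hdet : (1 - t • Matrix.vecMulVec e e).det = 1 - t := by
      have := Matrix.det_one_add_replicateCol_mul_replicateRow (ι := Unit) (-(t • e)) e
      rw [dotProduct_neg, dotProduct_smul, he] at this
      rw [← Matrix.vecMulVec_eq] at this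
      rw [← Matrix.smul_vecMulVec, sub_eq_add_neg, ← Matrix.neg_vecMulVec, this]
      simp [sub_eq_add_neg]
    have h := congrArg (fun M => M.mulVec e) (Matrix.adjugate_mul (1 - t • Matrix.vecMulVec e e))
    simp only [← Matrix.mulVec_mulVec, hM, hdet, Matrix.mulVec_smul, Matrix.smul_mulVec, Matrix.one_mulVec] at h
    exact smul_right_injective _ (sub_ne_zero.2 ht.symm) h
  have hcont : Continuous fun t : ℝ => (1 - t • Matrix.vecMulVec e e).adjugate.mulVec e := by
    apply Continuous.matrix_mulVec _ continuous_const
    apply Continuous.matrix_adjugate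
    fun_prop
  have h1 : Tendsto (fun t : ℝ => (1 - t • Matrix.vecMulVec e e).adjugate.mulVec e) (𝓝[≠] 1) (𝓝 e) :=
    tendsto_const_nhds.congr' (eventually_nhdsWithin_of_forall fun t ht => (hne t ht).symm)
  have h2 := (hcont.tendsto 1).mono_left (nhdsWithin_le_nhds (s := {1}ᶜ))
  simpa using tendsto_nhds_unique h2 h1

theorem jac_proj (n : ℕ) (v : Euc n → Euc n) (x : Euc n) (hv : DifferentiableAt ℝ v x) (a : Euc n)
    (ha : v x ≠ a) :
    jacMat n (proj n v a) x = ‖v x - a‖⁻¹ • ((1 - Matrix.vecMulVec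
      (fun i => ‖v x - a‖⁻¹ * (v x - a) i) (fun i => ‖v x - a‖⁻¹ * (v x - a) i)) * jacMat n v x) := by
  have hne : v x - a ≠ 0 := sub_ne_zero.2 ha
  have hN : ‖v x - a‖ ≠ 0 := norm_ne_zero_iff.2 hne
  have hd : HasFDerivAt (fun x => v x - a) (fderiv ℝ v x) x := hv.hasFDerivAt.sub_const a
  have hs : HasFDerivAt (fun x => ‖v x - a‖ ^ 2) _ x := hd.norm_sq
  have hn0 := hs.sqrt (by positivity)
  simp only [Real.sqrt_sq (norm_nonneg _)] at hn0
  have hn1 := (hasDerivAt_inv hN).comp_hasFDerivAt x hn0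
  have hp : HasFDerivAt (proj n v a) _ x := HasFDerivAt.smul hn1 hd
  have hin : ∀ y : Euc n, inner ℝ (v x - a) y = ∑ l, (v x - a) l * y l := by
    intro y
    simp [PiLp.inner_apply, mul_comm]
  ext i j
  rw [jacMat, Matrix.of_apply, hp.fderiv, Matrix.smul_apply, Matrix.sub_mul, Matrix.one_mul,
    Matrix.sub_apply, Matrix.vecMulVec_mul]
  have h3 : Matrix.vecMul (fun i => ‖v x - a‖⁻¹ * (v x - a) i) (jacMat n v x) j
      = ‖v x - a‖⁻¹ * inner ℝ (v x - a) (fderiv ℝ v x (EuclideanSpace.single j 1)) := by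
    rw [hin, Finset.mul_sum]
    simp [Matrix.vecMul, dotProduct, jacMat, mul_assoc]
  rw [Matrix.vecMulVec_apply, h3]
  simp [jacMat, inner_sub_left]
  field_simp
  ring

theorem jPair_proj (n : ℕ) (v : Euc n → Euc n) (ψ : Euc n → ℝ) (x : Euc n)
    (hv : DifferentiableAt ℝ v x) (a : Euc n) :
    jPair n (proj n v a) ψ x = (n : ℝ)⁻¹ * ∑ k, (∑ i, (jacMat n v x).adjugate i k *
      fderiv ℝ ψ x (EuclideanSpace.single i 1)) * (‖v x - a‖⁻¹ ^ n * (v x - a) k) := by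
  have hvec : ∀ i, jvec n (proj n v a) x i = (n : ℝ)⁻¹ * ∑ k, (jacMat n v x).adjugate i k *
      (‖v x - a‖⁻¹ ^ n * (v x - a) k) := by
    intro i
    by_cases ha : v x = a
    · simp [jvec, proj, ha, Matrix.mulVec, dotProduct]
    have hne : v x - a ≠ 0 := sub_ne_zero.2 ha
    have hN : ‖v x - a‖ ≠ 0 := norm_ne_zero_iff.2 hne
    rw [jvec, jac_proj n v x hv a ha, Matrix.adjugate_smul, Matrix.adjugate_mul_distrib]
    have he : (fun i => ‖v x - a‖⁻¹ * (v x - a) i) ⬝ᵥ (fun i => ‖v x - a‖⁻¹ * (v x - a) i) = 1 := by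
      have := EuclideanSpace.real_norm_sq_eq (v x - a)
      have h2 : (fun i => ‖v x - a‖⁻¹ * (v x - a) i) ⬝ᵥ (fun i => ‖v x - a‖⁻¹ * (v x - a) i)
          = ‖v x - a‖⁻¹ ^ 2 * ∑ i, (v x - a) i ^ 2 := by
        rw [dotProduct, Finset.mul_sum]
        exact Finset.sum_congr rfl fun i _ => by ring
      rw [h2, ← this]
      field_simp
    have h3 := adj_proj n _ he
    have hp : (fun j => proj n v a x j) = (fun i => ‖v x - a‖⁻¹ * (v x - a) i) := by
      ext i; simp [proj]
    rw [hp, Matrix.smul_mulVec, ← Matrix.mulVec_mulVec, h3]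
    congr 1
    have hn : n = (n - 1) + 1 := by have := i.2; omega
    simp only [Pi.smul_apply, Matrix.mulVec, dotProduct, smul_eq_mul, Fintype.card_fin, Finset.mul_sum]
    refine Finset.sum_congr rfl fun k _ => ?_
    rw [show ‖v x - a‖⁻¹ ^ n = ‖v x - a‖⁻¹ ^ (n - 1) * ‖v x - a‖⁻¹ by rw [← pow_succ, ← hn]]
    ring
  simp only [jPair, hvec, Finset.mul_sum, Finset.sum_mul]
  rw [Finset.sum_comm]
  exact Finset.sum_congr rfl fun i _ => Finset.sum_congr rfl fun j _ => by ring

theorem K_meas (n : ℕ) (k : Fin n) : Measurable fun z : Euc n => ‖z‖⁻¹ ^ n * z k := by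
  fun_prop

theorem K_bound (n : ℕ) (k : Fin n) (z : Euc n) : ‖‖z‖⁻¹ ^ n * z k‖ ≤ 1 * ‖z‖ ^ (-((n : ℝ) - 1)) := by
  by_cases hz : z = 0
  · subst hz
    simp
    positivity
  have hN : 0 < ‖z‖ := norm_pos_iff.2 hz
  have h1 : ‖z k‖ ≤ ‖z‖ := PiLp.norm_apply_le z k
  rw [norm_mul, neg_sub, Real.rpow_sub hN, Real.rpow_one, Real.rpow_natCast, norm_pow, norm_inv, norm_norm,
    one_mul, inv_pow, div_eq_mul_inv, mul_comm]
  gcongr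

theorem K_loc (n : ℕ) (k : Fin n) : LocallyIntegrable fun z : Euc n => ‖z‖⁻¹ ^ n * z k := by
  have hn : 1 ≤ n := by have := k.2; omega
  refine locallyIntegrable_of_norm_le_rpow (C := 1) (α := (n : ℝ) - 1) ?_ ?_ ?_
    (K_meas n k).aestronglyMeasurable
  · simpa using hn
  · simp
  · exact Eventually.of_forall (K_bound n k)

theorem ray_integral (n : ℕ) (η : Euc n → ℝ) (hη : ContDiff ℝ 1 η) (hc : HasCompactSupport η)
    (y θ : Euc n) (hθ : ‖θ‖ = 1) : ∫ r in Set.Ioi (0:ℝ), fderiv ℝ η (y - r • θ) θ = η y := by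
  have hcont := hη.continuous_fderiv one_ne_zero
  obtain ⟨R, hR⟩ := hc.isBounded.subset_closedBall 0
  have hout : ∀ r : ℝ, R + ‖y‖ < r → y - r • θ ∉ tsupport η := by
    intro r hr h
    have h1 := hR h
    rw [mem_closedBall_zero_iff] at h1
    have h2 : ‖r • θ‖ ≤ ‖y‖ + ‖y - r • θ‖ := by
      have := norm_sub_le y (y - r • θ)
      simpa using this
    rw [norm_smul, hθ, mul_one] at h2
    have := le_abs_self r
    rw [Real.norm_eq_abs] at h2
    linarith
  have hd : ∀ r ∈ Set.Ici (0:ℝ), HasDerivAt (fun r : ℝ => - η (y - r • θ)) (fderiv ℝ η (y - r • θ) θ) r := by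
    intro r _
    have h1 : HasDerivAt (fun r : ℝ => y - r • θ) (-θ) r := by
      simpa using ((hasDerivAt_id r).smul_const θ).const_sub y
    have := ((hη.differentiable one_ne_zero (y - r • θ)).hasFDerivAt.comp_hasDerivAt r h1).neg
    rw [map_neg, neg_neg] at this
    exact this
  have hlim : Tendsto (fun r : ℝ => - η (y - r • θ)) atTop (𝓝 0) := by
    refine tendsto_const_nhds.congr' ?_
    filter_upwards [eventually_gt_atTop (R + ‖y‖)] with r hr
    rw [image_eq_zero_of_notMem_tsupport (hout r hr), neg_zero]
  have hintg : IntegrableOn (fun r : ℝ => fderiv ℝ η (y - r • θ) θ) (Set.Ioi 0) := by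
    have hc1 : Continuous (fun r : ℝ => fderiv ℝ η (y - r • θ) θ) := by fun_prop
    have h1 : IntegrableOn (fun r : ℝ => fderiv ℝ η (y - r • θ) θ) (Set.Icc 0 (R + ‖y‖)) :=
      hc1.continuousOn.integrableOn_compact isCompact_Icc
    refine h1.of_forall_sdiff_eq_zero measurableSet_Ioi ?_
    intro r hr
    have : R + ‖y‖ < r := by
      by_contra h
      exact hr.2 ⟨le_of_lt hr.1, not_lt.1 h⟩
    have h2 : y - r • θ ∉ Function.support (fderiv ℝ η) := fun h => hout r this (support_fderiv_subset ℝ h)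
    rw [Function.notMem_support.1 h2]
    rfl
  have := integral_Ioi_of_hasDerivAt_of_tendsto' hd hintg hlim
  rw [this]
  simp

theorem div_integral (n : ℕ) (hn : 1 ≤ n) (η : Euc n → ℝ) (hη : ContDiff ℝ 1 η)
    (hc : HasCompactSupport η) (y : Euc n)
    (hintg : Integrable fun z : Euc n => ‖z‖⁻¹ ^ n * fderiv ℝ η (y - z) z) :
    ∫ z : Euc n, ‖z‖⁻¹ ^ n * fderiv ℝ η (y - z) z = n * ballVol n * η y := by
  have : Nonempty (Fin n) := ⟨⟨0, hn⟩⟩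
  have : Nontrivial (Euc n) := Module.nontrivial_of_finrank_pos (R := ℝ) (by simp; omega)
  set μ : Measure (Euc n) := volume
  have hmp := μ.measurePreserving_homeomorphUnitSphereProd
  have hme : MeasurableEmbedding (homeomorphUnitSphereProd (Euc n)) := Homeomorph.measurableEmbedding _
  set F : sphere (0 : Euc n) 1 × Set.Ioi (0:ℝ) → ℝ := fun p =>
    p.2.1⁻¹ ^ (n - 1) * fderiv ℝ η (y - p.2.1 • p.1.1) p.1.1 with hF
  have hFe : ∀ z : ({0}ᶜ : Set (Euc n)), F (homeomorphUnitSphereProd (Euc n) z)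
      = ‖z.1‖⁻¹ ^ n * fderiv ℝ η (y - z.1) z.1 := by
    intro z
    have hz : ‖z.1‖ ≠ 0 := norm_ne_zero_iff.2 z.2
    have e : ‖z.1‖⁻¹ ^ n = ‖z.1‖⁻¹ ^ (n - 1) * ‖z.1‖⁻¹ := by
      rw [← pow_succ]; congr 1; omega
    simp only [hF, homeomorphUnitSphereProd_apply_snd_coe, homeomorphUnitSphereProd_apply_fst_coe, smul_smul, mul_inv_cancel₀ hz, one_smul, map_smul, smul_eq_mul, e]
    ring
  have hI : ∫ z : Euc n, ‖z‖⁻¹ ^ n * fderiv ℝ η (y - z) z ∂μ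
      = ∫ p, F p ∂(μ.toSphere.prod (Measure.volumeIoiPow (Module.finrank ℝ (Euc n) - 1))) := by
    rw [← hmp.integral_comp hme]
    simp only [hFe]
    rw [integral_subtype_comap (measurableSet_singleton _).compl fun z : Euc n => ‖z‖⁻¹ ^ n * fderiv ℝ η (y - z) z,
        restrict_compl_singleton]
  have hFint : Integrable F (μ.toSphere.prod (Measure.volumeIoiPow (Module.finrank ℝ (Euc n) - 1))) := by
    rw [← hmp.integrable_comp_emb hme]
    have h1 : (F ∘ homeomorphUnitSphereProd (Euc n)) = (fun z : Euc n => ‖z‖⁻¹ ^ n * fderiv ℝ η (y - z) z) ∘ Subtype.val := by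
      ext z; exact hFe z
    rw [h1, ← integrableOn_iff_comap_subtypeVal (measurableSet_singleton _).compl]
    exact hintg.integrableOn
  rw [hI, integral_prod _ hFint]
  have hin : ∀ θ : sphere (0 : Euc n) 1, ∫ r, F (θ, r) ∂(Measure.volumeIoiPow (Module.finrank ℝ (Euc n) - 1)) = η y := by
    intro θ
    have hθ : ‖θ.1‖ = 1 := by simp
    rw [← ray_integral n η hη hc y θ.1 hθ]
    simp only [Measure.volumeIoiPow, ENNReal.ofReal]
    rw [integral_withDensity_eq_integral_smul]
    · simp only [hF]
      rw [integral_subtype_comap measurableSet_Ioi fun r : ℝ => Real.toNNReal (r ^ (Module.finrank ℝ (Euc n) - 1)) • (r⁻¹ ^ (n - 1) * fderiv ℝ η (y - r • θ.1) θ.1)]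
      refine setIntegral_congr_fun measurableSet_Ioi fun r hr => ?_
      have hr' : (0:ℝ) < r := hr
      rw [NNReal.smul_def, Real.coe_toNNReal _ (pow_nonneg hr'.le _), finrank_euclideanSpace_fin, smul_eq_mul, ← mul_assoc, ← mul_pow, mul_inv_cancel₀ hr'.ne', one_pow, one_mul]
    · exact (measurable_subtype_coe.pow_const _).real_toNNReal
  simp only [hin]
  rw [integral_const, μ.toSphere_real_apply_univ, finrank_euclideanSpace_fin, smul_eq_mul]
  rfl

theorem conv_exists (n : ℕ) (hn : 1 ≤ n) (η : Euc n → ℝ) (hη : ContDiff ℝ 1 η)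
    (hc : HasCompactSupport η) : ∃ f : Fin n → Euc n → ℝ, (∀ k, ContDiff ℝ 1 (f k)) ∧
    (∀ k y, f k y = ∫ a : Euc n, (‖y - a‖⁻¹ ^ n * (y - a) k) * η a) ∧
    (∀ y, ∑ k, fderiv ℝ (f k) y (EuclideanSpace.single k 1) = n * ballVol n * η y) := by
  have hcont := hη.continuous_fderiv one_ne_zero
  set K : Fin n → Euc n → ℝ := fun k z => ‖z‖⁻¹ ^ n * z k with hK
  let L := ContinuousLinearMap.mul ℝ ℝ
  refine ⟨fun k => convolution (K k) η L volume, ?_, ?_, ?_⟩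
  · intro k
    exact hc.contDiff_convolution_right L (K_loc n k) hη
  · intro k y
    change ∫ z, L (K k z) (η (y - z)) = _
    rw [← integral_sub_left_eq_self _ volume y]
    simp [L, hK]
  · intro y
    have hintg : ∀ k, Integrable fun z => K k z * fderiv ℝ η (y - z) (EuclideanSpace.single k 1) := by
      intro k
      refine (K_loc n k).integrable_smul_right_of_hasCompactSupport (g := fun z => fderiv ℝ η (y - z) (EuclideanSpace.single k 1)) (by fun_prop) ?_
      have h1 : HasCompactSupport fun z => fderiv ℝ η z (EuclideanSpace.single k 1) := hc.fderiv_apply ℝ _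
      exact h1.comp_homeomorph (Homeomorph.subLeft y)
    have hsum : ∀ z : Euc n, ∑ k, K k z * fderiv ℝ η (y - z) (EuclideanSpace.single k 1)
        = ‖z‖⁻¹ ^ n * fderiv ℝ η (y - z) z := by
      intro z
      have h1 : fderiv ℝ η (y - z) z = ∑ k, z k * fderiv ℝ η (y - z) (EuclideanSpace.single k 1) := by
        have h2 := congrArg (fderiv ℝ η (y - z)) (euc_sum_single n z)
        rw [map_sum] at h2
        simpa using h2
      rw [h1, Finset.mul_sum]
      exact Finset.sum_congr rfl fun k _ => by simp [hK, mul_assoc]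
    have hd : ∀ k, fderiv ℝ (convolution (K k) η L volume) y (EuclideanSpace.single k 1)
        = ∫ z, K k z * fderiv ℝ η (y - z) (EuclideanSpace.single k 1) := by
      intro k
      rw [(hc.hasFDerivAt_convolution_right L (K_loc n k) hη y).fderiv]
      rw [convolution_precompR_apply L (K_loc n k) (hc.fderiv ℝ) hcont]
      rfl
    simp only [hd]
    rw [← integral_finsetSum _ fun k _ => hintg k]
    simp only [hsum]
    refine div_integral n hn η hη hc y ?_
    simp only [← hsum]
    exact integrable_finsetSum _ fun k _ => hintg k

theorem K_shift (n : ℕ) (k : Fin n) (y : Euc n) (R : ℝ) :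
    IntegrableOn (fun a : Euc n => ‖y - a‖⁻¹ ^ n * (y - a) k) (closedBall 0 R) ∧
    ∫ a in closedBall (0 : Euc n) R, ‖‖y - a‖⁻¹ ^ n * (y - a) k‖ =
      ∫ z in closedBall y R, ‖‖z‖⁻¹ ^ n * z k‖ := by
  have hmp := Measure.measurePreserving_sub_left (volume : Measure (Euc n)) y
  have hme : MeasurableEmbedding fun a : Euc n => y - a := (Homeomorph.subLeft y).measurableEmbedding
  have hpre : (fun a : Euc n => y - a) ⁻¹' (closedBall y R) = closedBall 0 R := by
    ext a
    simp [dist_eq_norm]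
  constructor
  · have h1 := (K_loc n k).integrableOn_isCompact (isCompact_closedBall y R)
    rw [← hmp.integrableOn_comp_preimage hme, hpre] at h1
    exact h1
  · have h := hmp.setIntegral_preimage_emb hme (fun z : Euc n => ‖‖z‖⁻¹ ^ n * z k‖) (closedBall y R)
    rw [hpre] at h
    exact h

theorem b_cont (n : ℕ) (v : Euc n → Euc n) (hv : ContDiff ℝ 1 v)
    (ψ : Euc n → ℝ) (hψ : ContDiff ℝ 1 ψ) (k : Fin n) :
    Continuous fun x => ∑ i, (jacMat n v x).adjugate i k * fderiv ℝ ψ x (EuclideanSpace.single i 1) := by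
  have := hψ.continuous_fderiv one_ne_zero
  refine continuous_finsetSum _ fun i _ => ?_
  exact ((jac_continuous n v hv).matrix_adjugate.matrix_elem i k).mul (by fun_prop)

theorem b_supp (n : ℕ) (v : Euc n → Euc n)
    (ψ : Euc n → ℝ) (hψc : HasCompactSupport ψ) (k : Fin n) :
    HasCompactSupport fun x => ∑ i, (jacMat n v x).adjugate i k * fderiv ℝ ψ x (EuclideanSpace.single i 1) := by
  refine HasCompactSupport.intro (hψc.fderiv ℝ).isCompact fun x hx => ?_
  rw [image_eq_zero_of_notMem_tsupport hx]
  simp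

theorem bK_int (n : ℕ) (v : Euc n → Euc n) (hv : Continuous v) (hvc : HasCompactSupport v)
    (b : Euc n → ℝ) (hb : Continuous b) (hbc : HasCompactSupport b) (k : Fin n) (R : ℝ) :
    Integrable (fun p : Euc n × Euc n => b p.2 * (‖v p.2 - p.1‖⁻¹ ^ n * (v p.2 - p.1) k))
      ((volume.restrict (closedBall 0 R)).prod volume) := by
  obtain ⟨M, hM⟩ := hv.bounded_above_of_compact_support hvc
  have hmeas : AEStronglyMeasurable (fun p : Euc n × Euc n => b p.2 * (‖v p.2 - p.1‖⁻¹ ^ n * (v p.2 - p.1) k))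
      ((volume.restrict (closedBall 0 R)).prod volume) := by
    have h1 : Measurable fun p : Euc n × Euc n => v p.2 - p.1 := by
      have : Continuous fun p : Euc n × Euc n => v p.2 - p.1 := by fun_prop
      exact this.measurable
    exact ((hb.comp continuous_snd).measurable.mul ((K_meas n k).comp h1)).aestronglyMeasurable
  rw [integrable_prod_iff' hmeas]
  constructor
  · exact Eventually.of_forall fun x => (K_shift n k (v x) R).1.const_mul (b x)
  · set C := ∫ z in closedBall (0 : Euc n) (M + R), ‖‖z‖⁻¹ ^ n * z k‖ with hC
    have hbi : Integrable (fun x => ‖b x‖ * C) := ((hb.integrable_of_hasCompactSupport hbc).norm).mul_const C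
    refine hbi.mono' hmeas.norm.prod_swap.integral_prod_right' (Eventually.of_forall fun x => ?_)
    rw [Real.norm_of_nonneg (integral_nonneg fun _ => norm_nonneg _)]
    simp only [norm_mul (b x)]
    rw [integral_const_mul]
    refine mul_le_mul_of_nonneg_left ?_ (norm_nonneg _)
    rw [(K_shift n k (v x) R).2]
    refine setIntegral_mono_set ?_ (Eventually.of_forall fun _ => norm_nonneg _) ?_
    · exact ((K_loc n k).integrableOn_isCompact (isCompact_closedBall _ _)).norm
    · refine LE.le.eventuallyLE (closedBall_subset_closedBall' ?_)
      rw [dist_zero_right, add_comm]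
      linarith [hM x]

theorem H_int (n : ℕ) (v : Euc n → Euc n) (hv : ContDiff ℝ 1 v) (hvc : HasCompactSupport v)
    (ψ : Euc n → ℝ) (hψ : ContDiff ℝ 1 ψ) (hψc : HasCompactSupport ψ) (R : ℝ) :
    Integrable (fun p : Euc n × Euc n => jPair n (proj n v p.1) ψ p.2)
      ((volume.restrict (closedBall 0 R)).prod volume) := by
  simp only [fun p : Euc n × Euc n => jPair_proj n v ψ p.2 (hv.differentiable one_ne_zero p.2) p.1]
  refine Integrable.const_mul (integrable_finsetSum _ fun k _ => ?_) _
  exact bK_int n v hv.continuous hvc _ (b_cont n v hv ψ hψ k) (b_supp n v ψ hψc k) k R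

theorem distr_id (n : ℕ) (hn : 1 ≤ n) (v : Euc n → Euc n) (hv : ContDiff ℝ 1 v) (hvc : HasCompactSupport v)
    (ψ : Euc n → ℝ) (hψ : ContDiff ℝ 1 ψ) (hψc : HasCompactSupport ψ)
    (η : Euc n → ℝ) (hη : ContDiff ℝ 1 η) (hηc : HasCompactSupport η) :
    ∫ a, η a * ∫ x, jPair n (proj n v a) ψ x = - ballVol n * ∫ x, (jacMat n v x).det * ψ x * η (v x) := by
  obtain ⟨f, hf, hfe, hfd⟩ := conv_exists n hn η hη hηc
  obtain ⟨R, hR⟩ := hηc.isBounded.subset_closedBall 0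
  have hout : ∀ a ∉ closedBall (0 : Euc n) R, η a = 0 := fun a ha =>
    image_eq_zero_of_notMem_tsupport fun h => ha (hR h)
  obtain ⟨B, hB⟩ := hη.continuous.bounded_above_of_compact_support hηc
  have hintg := H_int n v hv hvc ψ hψ hψc R
  set b : Fin n → Euc n → ℝ := fun k x => ∑ i, (jacMat n v x).adjugate i k * fderiv ℝ ψ x (EuclideanSpace.single i 1) with hb
  have hbc : ∀ k, Continuous (b k) := b_cont n v hv ψ hψ
  have hbs : ∀ k, HasCompactSupport (b k) := b_supp n v ψ hψc
  have hJ := jac_continuous n v hv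
  have h1 : ∫ a, η a * ∫ x, jPair n (proj n v a) ψ x
      = ∫ a in closedBall 0 R, ∫ x, η a * jPair n (proj n v a) ψ x := by
    simp only [integral_const_mul]
    symm
    apply setIntegral_eq_integral_of_forall_compl_eq_zero
    intro a ha
    rw [hout a ha, zero_mul]
  have h2 : ∫ a in closedBall 0 R, ∫ x, η a * jPair n (proj n v a) ψ x
      = ∫ x, ∫ a in closedBall 0 R, η a * jPair n (proj n v a) ψ x := by
    apply integral_integral_swap
    exact hintg.bdd_mul (c := B) (hη.continuous.comp continuous_fst).aestronglyMeasurable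
      (Eventually.of_forall fun p => hB p.1)
  have h3 : ∀ x, ∫ a in closedBall 0 R, η a * jPair n (proj n v a) ψ x
      = (n : ℝ)⁻¹ * ∑ k, b k x * f k (v x) := by
    intro x
    have h4 : ∀ k, ∫ a in closedBall 0 R, (‖v x - a‖⁻¹ ^ n * (v x - a) k) * η a = f k (v x) := by
      intro k
      rw [hfe]
      apply setIntegral_eq_integral_of_forall_compl_eq_zero
      intro a ha
      rw [hout a ha, mul_zero]
    have h5 : ∀ a, η a * jPair n (proj n v a) ψ x =
        (n : ℝ)⁻¹ * ∑ k, b k x * ((‖v x - a‖⁻¹ ^ n * (v x - a) k) * η a) := by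
      intro a
      rw [jPair_proj n v ψ x (hv.differentiable one_ne_zero x), mul_left_comm, Finset.mul_sum]
      congr 1
      exact Finset.sum_congr rfl fun k _ => by simp only [hb]; ring
    simp only [h5]
    rw [integral_const_mul, integral_finsetSum]
    · simp only [integral_const_mul, h4]
    · intro k _
      refine Integrable.const_mul ?_ _
      exact (K_shift n k (v x) R).1.mul_bdd (c := B) hη.continuous.aestronglyMeasurable (Eventually.of_forall hB)
  rw [h1, h2]
  simp only [h3]
  rw [integral_const_mul]
  have hq : ∀ k, Integrable fun x => b k x * f k (v x)
      + ψ x * fderiv ℝ (f k) (v x) (EuclideanSpace.single k 1) * (jacMat n v x).det := by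
    intro k
    have hfc := (hf k).continuous_fderiv one_ne_zero
    have hvc' := hv.continuous
    have hfk := (hf k).continuous
    refine Integrable.add ?_ ?_
    · refine Continuous.integrable_of_hasCompactSupport ((hbc k).mul (by fun_prop)) (hbs k).mul_right
    · refine Continuous.integrable_of_hasCompactSupport
        ((hψ.continuous.mul (by fun_prop)).mul hJ.matrix_det) ?_
      exact (hψc.mul_right).mul_right
  have hr : Integrable fun x => (n * ballVol n) * ((jacMat n v x).det * ψ x * η (v x)) := by
    refine Integrable.const_mul ?_ _
    refine Continuous.integrable_of_hasCompactSupport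
        ((hJ.matrix_det.mul hψ.continuous).mul (hη.continuous.comp hv.continuous)) ?_
    exact (hψc.mul_left).mul_right
  have h6 : ∀ x, ∑ k, b k x * f k (v x) = (∑ k, (b k x * f k (v x)
      + ψ x * fderiv ℝ (f k) (v x) (EuclideanSpace.single k 1) * (jacMat n v x).det))
      - (n * ballVol n) * ((jacMat n v x).det * ψ x * η (v x)) := by
    intro x
    rw [Finset.sum_add_distrib, ← Finset.sum_mul, ← Finset.mul_sum, hfd]
    ring
  simp only [h6]
  rw [integral_sub (integrable_finsetSum _ fun k _ => hq k) hr, integral_finsetSum _ fun k _ => hq k,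
    Finset.sum_eq_zero fun k _ => piola n v hv hvc ψ hψ hψc (f k) (hf k) k, integral_const_mul]
  have : (n : ℝ) ≠ 0 := by positivity
  field_simp
  ring

theorem global_coarea (n : ℕ) (hn : 1 ≤ n) (v : Euc n → Euc n) (hv : ContDiff ℝ 1 v) (hvc : HasCompactSupport v)
    (ψ : Euc n → ℝ) (hψ : ContDiff ℝ 1 ψ) (hψc : HasCompactSupport ψ) :
    (∀ᵐ a : Euc n, Integrable (fun x => jPair n (proj n v a) ψ x)) ∧
    Integrable (fun a : Euc n => ∫ x, jPair n (proj n v a) ψ x) ∧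
    ∫ a, ∫ x, jPair n (proj n v a) ψ x = - ballVol n * ∫ x, (jacMat n v x).det * ψ x := by
  have hH := H_int n v hv hvc ψ hψ hψc
  have hD := distr_id n hn v hv hvc ψ hψ hψc
  set G : Euc n → ℝ := fun a => ∫ x, jPair n (proj n v a) ψ x with hG
  obtain ⟨M0, hM0⟩ := hv.continuous.bounded_above_of_compact_support hvc
  set M := max M0 1 with hMdef
  have hM : ∀ x, ‖v x‖ ≤ M := fun x => (hM0 x).trans (le_max_left _ _)
  have hMpos : 0 < M := lt_of_lt_of_le one_pos (le_max_right _ _)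
  have hGint : ∀ R, IntegrableOn G (closedBall 0 R) := fun R => (hH R).integral_prod_left
  have hloc : LocallyIntegrable G := by
    rw [locallyIntegrable_iff]
    intro K hK
    obtain ⟨R, hR⟩ := hK.isBounded.subset_closedBall 0
    exact (hGint R).mono_set hR
  have hU : IsOpen (closedBall (0 : Euc n) M)ᶜ := isClosed_closedBall.isOpen_compl
  have hzero : ∀ᵐ a : Euc n, a ∈ (closedBall (0 : Euc n) M)ᶜ → G a = 0 := by
    refine hU.ae_eq_zero_of_integral_contDiff_smul_eq_zero (hloc.locallyIntegrableOn _) ?_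
    intro g hg hgc hgs
    have h1 := hD g (hg.of_le (by norm_cast)) hgc
    simp only [smul_eq_mul]
    rw [h1]
    have : ∀ x, g (v x) = 0 := fun x => image_eq_zero_of_notMem_tsupport fun h =>
      hgs h (by simpa using hM x)
    simp [this]
  refine ⟨?_, ?_, ?_⟩
  · have h1 : ∀ m : ℕ, ∀ᵐ a : Euc n, a ∈ closedBall (0 : Euc n) m → Integrable (fun x => jPair n (proj n v a) ψ x) := by
      intro m
      rw [← ae_restrict_iff' measurableSet_closedBall]
      exact (hH m).prod_right_ae
    filter_upwards [ae_all_iff.2 h1] with a ha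
    obtain ⟨m, hm⟩ := exists_nat_ge ‖a‖
    exact ha m (by simpa using hm)
  · have h1 : Integrable ((closedBall (0 : Euc n) M).indicator G) :=
      (integrable_indicator_iff measurableSet_closedBall).2 (hGint M)
    refine h1.congr ?_
    filter_upwards [hzero] with a ha
    by_cases h : a ∈ closedBall (0 : Euc n) M
    · simp only [Set.indicator_of_mem h]
    · rw [Set.indicator_of_notMem h, ha h]
  · let χ : ContDiffBump (0 : Euc n) := ⟨M, M + 1, hMpos, by linarith⟩
    have h1 := hD χ χ.contDiff χ.hasCompactSupport
    have hχ : ∀ a ∈ closedBall (0 : Euc n) M, χ a = 1 := fun a ha => χ.one_of_mem_closedBall ha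
    have h2 : ∫ a, χ a * G a = ∫ a, G a := by
      refine integral_congr_ae ?_
      filter_upwards [hzero] with a ha
      by_cases h : a ∈ closedBall (0 : Euc n) M
      · rw [hχ a h, one_mul]
      · rw [ha h, mul_zero]
    rw [h2] at h1
    rw [h1]
    have h3 : ∀ x, χ (v x) = 1 := fun x => hχ _ (by simpa using hM x)
    simp [h3]

theorem exists_global (n : ℕ) (Ω : Set (Euc n)) (hΩo : IsOpen Ω)
    (u : Euc n → Euc n) (hu : ContDiffOn ℝ 1 u Ω) (K : Set (Euc n)) (hK : IsCompact K)
    (hKΩ : K ⊆ Ω) :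
    ∃ v : Euc n → Euc n, ContDiff ℝ 1 v ∧ HasCompactSupport v ∧ ∀ x ∈ K, v =ᶠ[𝓝 x] u := by
  obtain ⟨L, hL, hKL, hLΩ⟩ := exists_compact_between hK hΩo hKΩ
  obtain ⟨χ, h1, h0, -⟩ := exists_contMDiffMap_one_nhds_of_subset_interior
    (modelWithCornersSelf ℝ (Euc n)) (n := (1 : ℕ∞)) hK.isClosed hKL
  have hχ : ContDiff ℝ 1 (χ : Euc n → ℝ) := χ.contMDiff.contDiff
  refine ⟨fun x => χ x • u x, ?_, HasCompactSupport.intro hL fun x hx => by simp [h0 x hx], ?_⟩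
  · rw [contDiff_iff_contDiffAt]
    intro x
    by_cases hx : x ∈ Ω
    · exact hχ.contDiffAt.smul (hu.contDiffAt (hΩo.mem_nhds hx))
    · have hxL : Lᶜ ∈ 𝓝 x := hL.isClosed.isOpen_compl.mem_nhds fun h => hx (hLΩ h)
      refine (contDiffAt_const (c := (0 : Euc n))).congr_of_eventuallyEq ?_
      filter_upwards [hxL] with y hy
      simp [h0 y hy]
  · intro x hx
    have := eventually_nhdsSet_iff_forall.1 h1 x hx
    filter_upwards [this] with y hy
    simp [hy]

/-- (Weak coarea formula for smooth maps.) -/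
theorem weak_coarea_formula_smooth
    (n : ℕ) (hn : 2 ≤ n) (Ω : Set (Euc n)) (hΩo : IsOpen Ω)
    (hΩb : Bornology.IsBounded Ω) (hΩs : SmoothBoundary n Ω)
    (u : Euc n → Euc n) (hu : ContDiffOn ℝ 1 u (closure Ω))
    (ψ : Euc n → ℝ) (hψ : Cc1 n Ω ψ) :
    (∀ᵐ a : Euc n, IntegrableOn (fun x => jPair n (proj n u a) ψ x) Ω) ∧
    Integrable (fun a : Euc n => -∫ x in Ω, jPair n (proj n u a) ψ x) volume ∧
    ∫ x in Ω, (jacMat n u x).det * ψ x =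
      (ballVol n)⁻¹ * ∫ a : Euc n, -∫ x in Ω, jPair n (proj n u a) ψ x := by
  obtain ⟨hψC, hψc, hψs⟩ := hψ
  obtain ⟨v, hv, hvc, hvu⟩ := exists_global n Ω hΩo u (hu.mono subset_closure) (tsupport ψ) hψc hψs
  have hfd : ∀ x ∉ tsupport ψ, fderiv ℝ ψ x = 0 := fun x hx =>
    image_eq_zero_of_notMem_tsupport fun h => hx (tsupport_fderiv_subset ℝ h)
  have hj0 : ∀ w : Euc n → Euc n, ∀ x ∉ tsupport ψ, jPair n w ψ x = 0 := by
    intro w x hx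
    simp [jPair, hfd x hx]
  have hj : ∀ a x, jPair n (proj n u a) ψ x = jPair n (proj n v a) ψ x := by
    intro a x
    by_cases hx : x ∈ tsupport ψ
    · have he : proj n v a =ᶠ[𝓝 x] proj n u a := by
        filter_upwards [hvu x hx] with y hy
        simp [proj, hy]
      simp only [jPair, jvec, jacMat, he.fderiv_eq, he.eq_of_nhds]
    · rw [hj0 _ x hx, hj0 _ x hx]
  have hd : ∀ x, (jacMat n u x).det * ψ x = (jacMat n v x).det * ψ x := by
    intro x
    by_cases hx : x ∈ tsupport ψ
    · simp only [jacMat, (hvu x hx).fderiv_eq]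
    · rw [image_eq_zero_of_notMem_tsupport hx, mul_zero, mul_zero]
  have hI : ∀ a, ∫ x in Ω, jPair n (proj n u a) ψ x = ∫ x, jPair n (proj n v a) ψ x := by
    intro a
    simp only [hj]
    exact setIntegral_eq_integral_of_forall_compl_eq_zero fun x hx => hj0 _ x fun h => hx (hψs h)
  have hD : ∫ x in Ω, (jacMat n u x).det * ψ x = ∫ x, (jacMat n v x).det * ψ x := by
    simp only [hd]
    refine setIntegral_eq_integral_of_forall_compl_eq_zero fun x hx => ?_
    rw [image_eq_zero_of_notMem_tsupport fun h => hx (hψs h), mul_zero]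
  obtain ⟨g1, g2, g3⟩ := global_coarea n (by omega) v hv hvc ψ hψC hψc
  have hb : ballVol n ≠ 0 :=
    (ENNReal.toReal_pos (measure_ball_pos volume _ one_pos).ne' measure_ball_lt_top.ne).ne'
  refine ⟨?_, ?_, ?_⟩
  · filter_upwards [g1] with a ha
    simp only [hj]
    exact ha.integrableOn
  · simp only [hI]
    exact g2.neg
  · simp only [hI]
    rw [hD, integral_neg, g3]
    field_simp

end
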